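/- arXiv:math/0702569 — 2 statements merged into one kernel-verified Lean document; each statement's English description precedes it below -/
import Mathlib

section
/- Let K be a field, S = K[x,y,z,w], and I ⊆ S a monomial ideal with Ass(S/I) = {(x,y), (x,z), (z,w)}, and let I = P₁ ∩ P₂ ∩ P₃ be the irredundant primary decomposition of I into monomial primary ideals with √P₁ = (x,y), √P₂ = (x,z), √P₃ = (z,w). Then the following are equivalent: (i) S/I is clean; (ii) S/I is Cohen–Macaulay; (iii) P₂ ⊆ P₁ + P₃. -/
open MvPolynomial

/-- The depth of an `S`-module `M` with respect to an ideal `m`: the supremum of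
lengths of `M`-regular sequences consisting of elements of `m`. -/
noncomputable def mDepth (S : Type*) [CommRing S] (m : Ideal S)
    (M : Type*) [AddCommGroup M] [Module S M] : ℕ∞ :=
  sSup {n : ℕ∞ | ∃ rs : List S, (rs.length : ℕ∞) = n ∧ (∀ r ∈ rs, r ∈ m) ∧
    RingTheory.Sequence.IsRegular M rs}

/-- `M` is a Cohen–Macaulay `S`-module (w.r.t. the ideal `m`) if its depth with
respect to `m` equals its Krull dimension, i.e. the Krull dimension of `S ⧸ ann M`. -/
def IsCM (S : Type*) [CommRing S] (m : Ideal S)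
    (M : Type*) [AddCommGroup M] [Module S M] : Prop :=
  (mDepth S m M : WithBot ℕ∞) = ringKrullDim (S ⧸ Module.annihilator S M)

/-- `F` is a prime filtration `I = F₀ ⊆ F₁ ⊆ ... ⊆ F_r = S` with
`F_i/F_{i-1} ≅ S/P_i` for prime ideals `P_i`. -/
def IsPrimeFiltration {S : Type*} [CommRing S] (I : Ideal S) (r : ℕ)
    (F : Fin (r + 1) → Ideal S) (P : Fin r → Ideal S) : Prop :=
  F 0 = I ∧ F (Fin.last r) = ⊤ ∧ (∀ i : Fin r, F i.castSucc ≤ F i.succ) ∧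
  ∀ i : Fin r, (P i).IsPrime ∧
    Nonempty ((↥(Submodule.map (F i.castSucc).mkQ (F i.succ))) ≃ₗ[S] (S ⧸ P i))

/-- `S/I` is clean: it has a prime filtration all of whose primes are minimal
primes of `I`. -/
def IsClean {S : Type*} [CommRing S] (I : Ideal S) : Prop :=
  ∃ (r : ℕ) (F : Fin (r + 1) → Ideal S) (P : Fin r → Ideal S),
    IsPrimeFiltration I r F P ∧ ∀ i, P i ∈ I.minimalPrimes

/-- `S/I` is pretty clean: it has a prime filtration such that `i ≤ j` and
`P i ⊆ P j` imply `P i = P j`. -/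
def IsPrettyClean {S : Type*} [CommRing S] (I : Ideal S) : Prop :=
  ∃ (r : ℕ) (F : Fin (r + 1) → Ideal S) (P : Fin r → Ideal S),
    IsPrimeFiltration I r F P ∧ ∀ i j : Fin r, i ≤ j → P i ≤ P j → P i = P j

/-- A (finitely generated) `S`-module `M` is clean: it has a filtration
`0 = M₀ ⊆ M₁ ⊆ ... ⊆ M_r = M` with `M_i/M_{i-1} ≅ S/P_i` where each `P_i` is a
minimal prime of the support of `M`, i.e. a minimal prime over `ann M`. -/
def IsCleanModule (S : Type*) [CommRing S] (M : Type*) [AddCommGroup M] [Module S M] : Prop :=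
  ∃ (r : ℕ) (F : Fin (r + 1) → Submodule S M) (P : Fin r → Ideal S),
    F 0 = ⊥ ∧ F (Fin.last r) = ⊤ ∧ (∀ i : Fin r, F i.castSucc ≤ F i.succ) ∧
    (∀ i : Fin r, (P i).IsPrime ∧
      Nonempty ((↥(F i.succ) ⧸ (Submodule.comap (F i.succ).subtype (F i.castSucc)))
        ≃ₗ[S] (S ⧸ P i))) ∧
    ∀ i, P i ∈ (Module.annihilator S M).minimalPrimes

/-- An ideal of a polynomial ring is a monomial ideal if it is generated by monomials. -/
def IsMonomialIdeal {σ K : Type*} [CommSemiring K] (I : Ideal (MvPolynomial σ K)) : Prop :=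
  ∃ G : Set (MvPolynomial σ K),
    (∀ g ∈ G, ∃ e : σ →₀ ℕ, g = MvPolynomial.monomial e 1) ∧ I = Ideal.span G

/-- The height of an ideal: the infimum of the heights of the primes containing it. -/
noncomputable def idealHeight {S : Type*} [CommRing S] (I : Ideal S) : ℕ∞ :=
  sInf {n : ℕ∞ | ∃ q : PrimeSpectrum S, I ≤ q.asIdeal ∧ Order.height q = n}

variable {K : Type*} [Field K]

local notation "S" => MvPolynomial (Fin 4) K
local notation "m4" => (Ideal.span {(X 0 : MvPolynomial (Fin 4) K), X 1, X 2, X 3})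

section Regular

variable {R : Type*} [CommRing R]

open RingTheory.Sequence
open scoped Pointwise

/-- `(R ⧸ I) ⧸ r (R ⧸ I)` is `R ⧸ (I + (r))`. -/
noncomputable def quotSMulTopQuotientEquiv (I : Ideal R) (r : R) :
    QuotSMulTop r (R ⧸ I) ≃ₗ[R] R ⧸ (I ⊔ Ideal.span {r}) :=
  Submodule.quotEquivOfEq _ (Submodule.map I.mkQ (Ideal.span {r})) (by
    have h : Ideal.span {r} = r • (⊤ : Submodule R R) := by
      rw [← Submodule.ideal_span_singleton_smul]; simp
    rw [h, Submodule.map_pointwise_smul, Submodule.map_top, Submodule.range_mkQ]) ≪≫ₗ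
  Submodule.quotientQuotientEquivQuotientSup I (Ideal.span {r})

theorem isRegular_quotient_cons_iff (I : Ideal R) (r : R) (rs : List R) :
    IsRegular (R ⧸ I) (r :: rs) ↔
      (∀ a, r * a ∈ I → a ∈ I) ∧ IsRegular (R ⧸ (I ⊔ Ideal.span {r})) rs := by
  rw [isRegular_cons_iff, isSMulRegular_quotient_iff_mem_of_smul_mem,
    (quotSMulTopQuotientEquiv I r).isRegular_congr]
  rfl

theorem ringKrullDim_quotient_sup_span_add_one_le (I : Ideal R) {r : R}
    (hr : ∀ a, r * a ∈ I → a ∈ I) :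
    ringKrullDim (R ⧸ (I ⊔ Ideal.span {r})) + 1 ≤ ringKrullDim (R ⧸ I) := by
  refine ringKrullDim_succ_le_of_surjective (Ideal.Quotient.factor le_sup_left)
    (Ideal.Quotient.factor_surjective le_sup_left) (r := Ideal.Quotient.mk I r) ?_ ?_
  · rw [mem_nonZeroDivisors_iff_right]
    intro a ha
    obtain ⟨a, rfl⟩ := Ideal.Quotient.mk_surjective a
    rw [← map_mul, Ideal.Quotient.eq_zero_iff_mem, mul_comm] at ha
    exact Ideal.Quotient.eq_zero_iff_mem.2 (hr a ha)
  · rw [Ideal.Quotient.factor_mk, Ideal.Quotient.eq_zero_iff_mem]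
    exact Ideal.mem_sup_right (Ideal.mem_span_singleton_self r)

theorem length_le_ringKrullDim_of_isRegular (I : Ideal R) (rs : List R)
    (h : IsRegular (R ⧸ I) rs) : (rs.length : WithBot ℕ∞) ≤ ringKrullDim (R ⧸ I) := by
  induction rs generalizing I with
  | nil =>
    have := h.nontrivial
    simpa using ringKrullDim_nonneg_of_nontrivial (R := R ⧸ I)
  | cons r rs ih =>
    rw [isRegular_quotient_cons_iff] at h
    refine le_trans ?_ (ringKrullDim_quotient_sup_span_add_one_le I h.1)
    push_cast [List.length_cons]
    gcongr
    exact ih _ h.2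

theorem isCM_of_isRegular {m I : Ideal R} {rs : List R} (hm : ∀ r ∈ rs, r ∈ m)
    (hrs : IsRegular (R ⧸ I) rs) (hdim : ringKrullDim (R ⧸ I) ≤ rs.length) :
    IsCM R m (R ⧸ I) := by
  have hd := le_antisymm hdim (length_le_ringKrullDim_of_isRegular I rs hrs)
  rw [IsCM, Ideal.annihilator_quotient, hd]
  have : mDepth R m (R ⧸ I) = rs.length := by
    refine le_antisymm (sSup_le ?_) (le_sSup ⟨rs, rfl, hm, hrs⟩)
    rintro n ⟨ss, rfl, -, hss⟩
    have := length_le_ringKrullDim_of_isRegular I ss hss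
    rw [hd] at this
    exact_mod_cast this
  rw [this]; rfl

theorem exists_isRegular_of_isCM {m I : Ideal R} {n : ℕ} (hcm : IsCM R m (R ⧸ I))
    (hdim : (n : WithBot ℕ∞) ≤ ringKrullDim (R ⧸ I)) :
    ∃ rs : List R, n ≤ rs.length ∧ (∀ r ∈ rs, r ∈ m) ∧ IsRegular (R ⧸ I) rs := by
  by_contra! hcon
  rw [IsCM, Ideal.annihilator_quotient] at hcm
  rw [← hcm] at hdim
  have hdim' : (n : ℕ∞) ≤ mDepth R m (R ⧸ I) := by exact_mod_cast hdim
  rcases n with _ | n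
  · have : Nontrivial (R ⧸ I) := by
      by_contra hn
      rw [not_nontrivial_iff_subsingleton] at hn
      have h2 := ringKrullDim_eq_bot_of_subsingleton (R := R ⧸ I)
      rw [← hcm] at h2
      exact WithBot.coe_ne_bot h2
    exact hcon [] (by simp) (by simp) (IsRegular.nil R (R ⧸ I))
  · have : mDepth R m (R ⧸ I) ≤ n := by
      refine sSup_le ?_
      rintro k ⟨ss, rfl, hm, hss⟩
      have : ss.length ≤ n := by
        by_contra hlt
        exact hcon ss (by omega) hm hss
      exact_mod_cast this
    have := hdim'.trans this
    norm_cast at this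
    omega

/-- If `s, t` is a regular sequence on `R ⧸ (A ⊓ B)` and `s` is regular on `R ⧸ A` and `R ⧸ B`,
then no element outside `A ⊔ B` is multiplied into it by both `s` and `t`. -/
theorem mem_sup_of_regular_pair {A B : Ideal R} {s t u : R}
    (hsA : ∀ a, s * a ∈ A → a ∈ A) (hsB : ∀ a, s * a ∈ B → a ∈ B)
    (ht : ∀ a, t * a ∈ A ⊓ B ⊔ Ideal.span {s} → a ∈ A ⊓ B ⊔ Ideal.span {s})
    (hsu : s * u ∈ A ⊔ B) (htu : t * u ∈ A ⊔ B) : u ∈ A ⊔ B := by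
  obtain ⟨a₁, ha₁, b₁, hb₁, h₁⟩ := Submodule.mem_sup.1 hsu
  obtain ⟨a₂, ha₂, b₂, hb₂, h₂⟩ := Submodule.mem_sup.1 htu
  have hmem : t * a₁ - s * a₂ ∈ A ⊓ B := by
    refine ⟨A.sub_mem (A.mul_mem_left _ ha₁) (A.mul_mem_left _ ha₂), ?_⟩
    have : t * a₁ - s * a₂ = s * b₂ - t * b₁ := by linear_combination t * h₁ - s * h₂
    rw [this]
    exact B.sub_mem (B.mul_mem_left _ hb₂) (B.mul_mem_left _ hb₁)
  have ha₁' : a₁ ∈ A ⊓ B ⊔ Ideal.span {s} := by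
    refine ht _ (Submodule.mem_sup.2 ⟨_, hmem, s * a₂,
      Ideal.mul_mem_right _ _ (Ideal.mem_span_singleton_self s), by ring⟩)
  obtain ⟨i, hi, e, he, h₃⟩ := Submodule.mem_sup.1 ha₁'
  obtain ⟨c, rfl⟩ := Ideal.mem_span_singleton'.1 he
  have hcA : c ∈ A := hsA _ (by
    have : s * c = a₁ - i := by linear_combination h₃
    rw [this]; exact A.sub_mem ha₁ hi.1)
  have hcB : u - c ∈ B := hsB _ (by
    have : s * (u - c) = b₁ + i := by linear_combination -h₁ - h₃
    rw [this]; exact B.add_mem hb₁ hi.2)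
  exact Submodule.mem_sup.2 ⟨c, hcA, u - c, hcB, by ring⟩

/-- If `A ⊔ B` is not saturated with respect to `m`, it has a socle element. -/
theorem exists_socle_of_pow_mul_le {m J : Ideal R} {u : R} (hu : u ∉ J) {n : ℕ}
    (hn : ∀ r ∈ m ^ n, r * u ∈ J) : ∃ v, v ∉ J ∧ ∀ r ∈ m, r * v ∈ J := by
  induction n generalizing u with
  | zero => exact absurd (by simpa using hn 1 (by simp)) hu
  | succ n ih =>
    by_cases h : ∀ r ∈ m ^ n, r * u ∈ J
    · exact ih hu h
    · push Not at h
      obtain ⟨r, hr, hru⟩ := h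
      refine ⟨r * u, hru, fun s hs => ?_⟩
      rw [← mul_assoc]
      exact hn _ (by rw [pow_succ']; exact Ideal.mul_mem_mul hs hr)

end Regular

section Filtration

variable {R : Type*} [CommRing R]

/-- `A ≤ B` is a step of a prime filtration with factor `R ⧸ p` for some prime `p ∈ T`. -/
def IsPrimeStep (T : Set (Ideal R)) (A B : Ideal R) : Prop :=
  ∃ p ∈ T, p.IsPrime ∧ ∃ m, B = A ⊔ Ideal.span {m} ∧ ∀ c, c * m ∈ A ↔ c ∈ p

theorem map_mkQ_sup_span_singleton (A : Ideal R) (m : R) :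
    Submodule.map A.mkQ (A ⊔ Ideal.span {m}) = Submodule.span R {A.mkQ m} := by
  rw [Submodule.map_sup, show Submodule.map A.mkQ A = ⊥ by simp, bot_sup_eq,
    Ideal.span, Submodule.map_span, Set.image_singleton]

theorem torsionOf_mkQ_eq_iff (A p : Ideal R) (m : R) :
    Ideal.torsionOf R (R ⧸ A) (A.mkQ m) = p ↔ ∀ c, c * m ∈ A ↔ c ∈ p := by
  rw [SetLike.ext_iff]
  refine forall_congr' fun c => ?_
  rw [Ideal.mem_torsionOf_iff, ← map_smul, Submodule.mkQ_apply, Submodule.Quotient.mk_eq_zero,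
    smul_eq_mul]

theorem nonempty_map_mkQ_equiv_iff {A B p : Ideal R} (hAB : A ≤ B) :
    Nonempty (↥(Submodule.map A.mkQ B) ≃ₗ[R] (R ⧸ p)) ↔
      ∃ m, B = A ⊔ Ideal.span {m} ∧ ∀ c, c * m ∈ A ↔ c ∈ p := by
  constructor
  · rintro ⟨e⟩
    obtain ⟨m, hmB, hm⟩ := (e.symm (Submodule.Quotient.mk 1)).2
    have he (c : R) : A.mkQ (c * m) = e.symm (Submodule.Quotient.mk c) := by
      rw [← smul_eq_mul, map_smul, hm, ← Submodule.coe_smul, ← map_smul,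
        ← Submodule.Quotient.mk_smul, smul_eq_mul, mul_one]
    refine ⟨m, le_antisymm (fun b hb => ?_) (sup_le hAB ?_), fun c => ?_⟩
    · obtain ⟨c, hc⟩ := Submodule.Quotient.mk_surjective _ (e ⟨A.mkQ b, b, hb, rfl⟩)
      have h := he c
      rw [hc, LinearEquiv.symm_apply_apply] at h
      have h : A.mkQ b = A.mkQ (c * m) := h.symm
      rw [← sub_eq_zero, ← map_sub, Submodule.mkQ_apply, Submodule.Quotient.mk_eq_zero] at h
      exact Submodule.mem_sup.2 ⟨_, h, c * m,
        Ideal.mul_mem_left _ _ (Ideal.mem_span_singleton_self m), by ring⟩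
    · rwa [Ideal.span_singleton_le_iff_mem]
    · rw [← Submodule.Quotient.mk_eq_zero A, ← Submodule.mkQ_apply, he,
        ZeroMemClass.coe_eq_zero, LinearEquiv.map_eq_zero_iff, Submodule.Quotient.mk_eq_zero]
  · rintro ⟨m, rfl, hm⟩
    rw [← torsionOf_mkQ_eq_iff] at hm
    exact ⟨LinearEquiv.ofEq _ _ (map_mkQ_sup_span_singleton A m) ≪≫ₗ
      (Ideal.quotTorsionOfEquivSpanSingleton R _ (A.mkQ m)).symm ≪≫ₗ
      Submodule.quotEquivOfEq _ _ hm⟩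

theorem exists_filtration_of_reflTransGen {T : Set (Ideal R)} {I : Ideal R}
    (h : Relation.ReflTransGen (IsPrimeStep T) I ⊤) :
    ∃ (r : ℕ) (F : Fin (r + 1) → Ideal R) (P : Fin r → Ideal R),
      IsPrimeFiltration I r F P ∧ ∀ i, P i ∈ T := by
  induction h using Relation.ReflTransGen.head_induction_on with
  | refl => exact ⟨0, fun _ => ⊤, Fin.elim0, ⟨rfl, rfl, fun i => i.elim0, fun i => i.elim0⟩,
      fun i => i.elim0⟩
  | @head A B hstep _ ih =>
    obtain ⟨p, hpT, hp, m, hB, hm⟩ := hstep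
    obtain ⟨r, F, P, ⟨h0, hl, hle, hF⟩, hP⟩ := ih
    have hAB : A ≤ B := hB ▸ le_sup_left
    refine ⟨r + 1, Fin.cons A F, Fin.cons p P, ⟨rfl, ?_, ?_, ?_⟩, ?_⟩
    · rwa [← Fin.succ_last, Fin.cons_succ]
    · refine Fin.cases ?_ fun i => ?_
      · simpa [h0] using hAB
      · simpa [← Fin.succ_castSucc] using hle i
    · refine Fin.cases ?_ fun i => ?_
      · rw [Fin.castSucc_zero, Fin.cons_succ, Fin.cons_zero, Fin.cons_zero, h0,
          nonempty_map_mkQ_equiv_iff hAB]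
        exact ⟨hp, m, hB, hm⟩
      · exact hF i
    · exact Fin.cases hpT hP

theorem reflTransGen_of_isPrimeFiltration {T : Set (Ideal R)} {I : Ideal R} {r : ℕ}
    {F : Fin (r + 1) → Ideal R} {P : Fin r → Ideal R} (h : IsPrimeFiltration I r F P)
    (hP : ∀ i, P i ∈ T) : Relation.ReflTransGen (IsPrimeStep T) I ⊤ := by
  obtain ⟨h0, hl, hle, hF⟩ := h
  suffices ∀ i, Relation.ReflTransGen (IsPrimeStep T) I (F i) from hl ▸ this _
  intro i
  induction i using Fin.induction with
  | zero => rw [h0]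
  | succ i ih =>
    exact ih.tail ⟨P i, hP i, (hF i).1, (nonempty_map_mkQ_equiv_iff (hle i)).1 (hF i).2⟩

theorem isClean_iff_reflTransGen {I : Ideal R} :
    IsClean I ↔ Relation.ReflTransGen (IsPrimeStep I.minimalPrimes) I ⊤ :=
  ⟨fun ⟨_, _, _, h, hP⟩ => reflTransGen_of_isPrimeFiltration h hP,
    exists_filtration_of_reflTransGen⟩

/-- A pair that is regular on every `R ⧸ p`, `p ∈ T`, is regular on every module with a
filtration whose factors are of this form. -/
theorem regular_pair_of_reflTransGen {T : Set (Ideal R)} {I : Ideal R} {f g : R}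
    (h : Relation.ReflTransGen (IsPrimeStep T) I ⊤) (hf : ∀ p ∈ T, f ∉ p)
    (hg : ∀ p ∈ T, ∀ c, g * c ∈ p ⊔ Ideal.span {f} → c ∈ p ⊔ Ideal.span {f}) :
    (∀ a, f * a ∈ I → a ∈ I) ∧
      ∀ a, g * a ∈ I ⊔ Ideal.span {f} → a ∈ I ⊔ Ideal.span {f} := by
  have hmf (B : Ideal R) (c : R) : c * f ∈ B ⊔ Ideal.span {f} :=
    Ideal.mem_sup_right (Ideal.mul_mem_left _ _ (Ideal.mem_span_singleton_self f))
  induction h using Relation.ReflTransGen.head_induction_on with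
  | refl => simp
  | @head A B hstep _ ih =>
    obtain ⟨p, hpT, hp, m, rfl, hm⟩ := hstep
    obtain ⟨ih₁, ih₂⟩ := ih
    constructor
    · intro a ha
      obtain ⟨b, hb, d, hd, rfl⟩ := Submodule.mem_sup.1 (ih₁ a (Ideal.mem_sup_left ha))
      obtain ⟨c, rfl⟩ := Ideal.mem_span_singleton'.1 hd
      refine A.add_mem hb ((hm c).2 ?_)
      refine (hp.mem_or_mem ((hm (f * c)).1 ?_)).resolve_left (hf p hpT)
      have : f * c * m = f * (b + c * m) - f * b := by ring
      rw [this]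
      exact A.sub_mem ha (A.mul_mem_left _ hb)
    · intro a ha
      obtain ⟨e, he, d, hd, rfl⟩ := Submodule.mem_sup.1
        (ih₂ a (sup_le_sup_right (le_sup_left : A ≤ _) _ ha))
      obtain ⟨d, rfl⟩ := Ideal.mem_span_singleton'.1 hd
      obtain ⟨b, hb, c, hc, rfl⟩ := Submodule.mem_sup.1 he
      obtain ⟨c, rfl⟩ := Ideal.mem_span_singleton'.1 hc
      obtain ⟨b', hb', k, hk, hbk⟩ := Submodule.mem_sup.1 ha
      obtain ⟨k, rfl⟩ := Ideal.mem_span_singleton'.1 hk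
      have hk' : k - g * d ∈ A ⊔ Ideal.span {m} := ih₁ _ (Submodule.mem_sup.2
        ⟨g * b - b', A.sub_mem (A.mul_mem_left _ hb) hb', g * c * m,
          Ideal.mul_mem_left _ _ (Ideal.mem_span_singleton_self m), by
            linear_combination -hbk⟩)
      obtain ⟨b'', hb'', n, hn, hbn⟩ := Submodule.mem_sup.1 hk'
      obtain ⟨n, rfl⟩ := Ideal.mem_span_singleton'.1 hn
      have hp' : g * c - f * n ∈ p := (hm _).1 (by
        have : (g * c - f * n) * m = b' - g * b + f * b'' := by
          linear_combination -hbk - f * hbn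
        rw [this]
        exact A.add_mem (A.sub_mem hb' (A.mul_mem_left _ hb)) (A.mul_mem_left _ hb''))
      have hc' := hg p hpT c (Submodule.mem_sup.2 ⟨_, hp', n * f,
        Ideal.mul_mem_left _ _ (Ideal.mem_span_singleton_self f), by ring⟩)
      obtain ⟨q, hq, l, hl, rfl⟩ := Submodule.mem_sup.1 hc'
      obtain ⟨l, rfl⟩ := Ideal.mem_span_singleton'.1 hl
      have : b + (q + l * f) * m + d * f = b + q * m + (l * m + d) * f := by ring
      rw [this]
      exact Ideal.add_mem _ (Ideal.mem_sup_left (A.add_mem hb ((hm q).2 hq))) (hmf _ _)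

theorem isPrimeStep_inf {T : Set (Ideal R)} {J Q p : Ideal R} (hpT : p ∈ T) (hp : p.IsPrime)
    {u v : R} (hv : v ∉ p) (hQ : ∀ c, c * u ∈ Q ↔ c ∈ p)
    (hJQ : ∀ c, c * u ∈ J ⊔ Q ↔ c ∈ p ⊔ Ideal.span {v}) :
    IsPrimeStep T (J ⊓ Q) (J ⊓ (Q ⊔ Ideal.span {u})) := by
  obtain ⟨j, hj, q, hq, hjq⟩ := Submodule.mem_sup.1
    ((hJQ v).2 (Ideal.mem_sup_right (Ideal.mem_span_singleton_self v)))
  have hjQ : j ∈ Q ⊔ Ideal.span {u} := Submodule.mem_sup.2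
    ⟨-q, Q.neg_mem hq, v * u, Ideal.mul_mem_left _ _ (Ideal.mem_span_singleton_self u), by
      linear_combination -hjq⟩
  refine ⟨p, hpT, hp, j, le_antisymm ?_ (sup_le (inf_le_inf_left _ le_sup_left) ?_), fun c => ?_⟩
  · rintro e ⟨heJ, heQ⟩
    obtain ⟨q', hq', z, hz, rfl⟩ := Submodule.mem_sup.1 heQ
    obtain ⟨c, rfl⟩ := Ideal.mem_span_singleton'.1 hz
    obtain ⟨π, hπ, z', hz', rfl⟩ := Submodule.mem_sup.1 ((hJQ c).1 (Submodule.mem_sup.2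
      ⟨q' + c * u, heJ, -q', Q.neg_mem hq', by ring⟩))
    obtain ⟨d, rfl⟩ := Ideal.mem_span_singleton'.1 hz'
    refine Submodule.mem_sup.2 ⟨q' + (π + d * v) * u - d * j, ⟨J.sub_mem heJ (J.mul_mem_left _ hj),
      ?_⟩, d * j, Ideal.mul_mem_left _ _ (Ideal.mem_span_singleton_self j), by ring⟩
    have : q' + (π + d * v) * u - d * j = q' + π * u + d * q := by linear_combination -d * hjq
    rw [this]
    exact Q.add_mem (Q.add_mem hq' ((hQ π).2 hπ)) (Q.mul_mem_left _ hq)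
  · rw [Ideal.span_singleton_le_iff_mem]
    exact ⟨hj, hjQ⟩
  · have : c * j = c * v * u - c * q := by linear_combination c * hjq
    have h1 : c * j ∈ J ⊓ Q ↔ c * v * u ∈ Q := by
      rw [this]
      refine ⟨fun h => ?_, fun h => ⟨this ▸ J.mul_mem_left _ hj, Q.sub_mem h (Q.mul_mem_left _ hq)⟩⟩
      have := Q.add_mem h.2 (Q.mul_mem_left c hq)
      rwa [sub_add_cancel] at this
    rw [h1, hQ]
    exact ⟨fun h => (hp.mem_or_mem h).resolve_right hv, fun h => p.mul_mem_right _ h⟩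

end Filtration

section MonomialIdeal

variable {σ k : Type*} [Field k]

/-- Membership of a monomial in `Q` only depends on its exponents at the variables in `s`. -/
def DependsOnlyOn (s : Set σ) (Q : Ideal (MvPolynomial σ k)) : Prop :=
  ∀ ⦃e e' : σ →₀ ℕ⦄, monomial e 1 ∈ Q → (∀ i ∈ s, e i ≤ e' i) → monomial e' 1 ∈ Q

theorem isMonomialIdeal_iff {I : Ideal (MvPolynomial σ k)} :
    IsMonomialIdeal I ↔
      ∃ s : Set (σ →₀ ℕ), I = Ideal.span ((fun e => monomial e (1 : k)) '' s) := by
  constructor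
  · rintro ⟨G, hG, rfl⟩
    refine ⟨{e | monomial e 1 ∈ G}, congrArg _ (Set.Subset.antisymm (fun g hg => ?_) ?_)⟩
    · obtain ⟨e, rfl⟩ := hG g hg
      exact ⟨e, hg, rfl⟩
    · rintro _ ⟨e, he, rfl⟩
      exact he
  · rintro ⟨s, rfl⟩
    refine ⟨_, ?_, rfl⟩
    rintro _ ⟨e, -, rfl⟩
    exact ⟨e, rfl⟩

theorem mem_of_forall_support {I : Ideal (MvPolynomial σ k)} {f : MvPolynomial σ k}
    (h : ∀ e ∈ f.support, monomial e 1 ∈ I) : f ∈ I := by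
  rw [f.as_sum]
  refine I.sum_mem fun e he => ?_
  rw [show monomial e (f.coeff e) = C (f.coeff e) * monomial e 1 by simp [C_mul_monomial]]
  exact I.mul_mem_left _ (h e he)

theorem monomial_mem_span_iff {s : Set (σ →₀ ℕ)} {e : σ →₀ ℕ} :
    monomial e (1 : k) ∈ Ideal.span ((fun e => monomial e (1 : k)) '' s) ↔ ∃ d ∈ s, d ≤ e := by
  classical
  rw [mem_ideal_span_monomial_image, support_monomial, if_neg one_ne_zero]
  simp

theorem monomial_mem_span_singleton_iff {d e : σ →₀ ℕ} :
    monomial e (1 : k) ∈ Ideal.span {monomial d (1 : k)} ↔ d ≤ e := by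
  simpa using monomial_mem_span_iff (k := k) (s := {d}) (e := e)

theorem isMonomialIdeal_span_singleton (d : σ →₀ ℕ) :
    IsMonomialIdeal (Ideal.span {monomial d (1 : k)}) :=
  ⟨{monomial d 1}, by simp, rfl⟩

namespace IsMonomialIdeal

variable {I J : Ideal (MvPolynomial σ k)}

theorem mem_iff (hI : IsMonomialIdeal I) {f : MvPolynomial σ k} :
    f ∈ I ↔ ∀ e ∈ f.support, monomial e 1 ∈ I := by
  obtain ⟨s, rfl⟩ := isMonomialIdeal_iff.1 hI
  simp_rw [monomial_mem_span_iff, mem_ideal_span_monomial_image]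

theorem sup (hI : IsMonomialIdeal I) (hJ : IsMonomialIdeal J) : IsMonomialIdeal (I ⊔ J) := by
  obtain ⟨G, hG, rfl⟩ := hI
  obtain ⟨H, hH, rfl⟩ := hJ
  exact ⟨G ∪ H, fun g hg => hg.elim (hG g) (hH g), (Ideal.span_union G H).symm⟩

theorem monomial_mem_sup_iff (hI : IsMonomialIdeal I) (hJ : IsMonomialIdeal J) {e : σ →₀ ℕ} :
    monomial e 1 ∈ I ⊔ J ↔ monomial e 1 ∈ I ∨ monomial e 1 ∈ J := by
  obtain ⟨s, rfl⟩ := isMonomialIdeal_iff.1 hI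
  obtain ⟨t, rfl⟩ := isMonomialIdeal_iff.1 hJ
  rw [← Ideal.span_union, ← Set.image_union]
  simp_rw [monomial_mem_span_iff, Set.mem_union, or_and_right, exists_or]

theorem mul_monomial_mem_iff (hI : IsMonomialIdeal I) {c : MvPolynomial σ k} {e : σ →₀ ℕ} :
    c * monomial e 1 ∈ I ↔ ∀ d ∈ c.support, monomial (d + e) 1 ∈ I := by
  classical
  rw [hI.mem_iff]
  refine ⟨fun h d hd => h _ ?_, fun h d hd => ?_⟩
  · rw [mem_support_iff, coeff_mul_monomial, mul_one]
    exact mem_support_iff.1 hd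
  · rw [mem_support_iff, coeff_mul_monomial'] at hd
    have hle : e ≤ d := by
      by_contra hne
      simp [hne] at hd
    rw [if_pos hle, mul_one] at hd
    simpa [tsub_add_cancel_of_le hle] using h _ (mem_support_iff.2 hd)

end IsMonomialIdeal

theorem monomial_mem_span_X_iff {s : Set σ} {e : σ →₀ ℕ} :
    monomial e (1 : k) ∈ Ideal.span (X '' s : Set (MvPolynomial σ k)) ↔ ∃ i ∈ s, e i ≠ 0 := by
  classical
  rw [mem_ideal_span_X_image, support_monomial, if_neg one_ne_zero]
  simp

theorem isMonomialIdeal_span_X (s : Set σ) :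
    IsMonomialIdeal (Ideal.span (X '' s : Set (MvPolynomial σ k))) := by
  refine ⟨_, ?_, rfl⟩
  rintro _ ⟨i, -, rfl⟩
  exact ⟨_, rfl⟩

open Classical in
/-- The `k`-algebra endomorphism sending the variables in `s` to zero. -/
noncomputable def killVars (s : Set σ) : MvPolynomial σ k →ₐ[k] MvPolynomial σ k :=
  aeval fun i => if i ∈ s then 0 else X i

open Classical in
@[simp]
theorem killVars_X (s : Set σ) (i : σ) :
    killVars s (X i : MvPolynomial σ k) = if i ∈ s then 0 else X i := by
  simp [killVars]

theorem mem_span_X_image_iff_killVars {s : Set σ} {f : MvPolynomial σ k} :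
    f ∈ Ideal.span (X '' s : Set (MvPolynomial σ k)) ↔ killVars s f = 0 := by
  constructor
  · intro h
    have : Ideal.span (X '' s : Set (MvPolynomial σ k)) ≤ RingHom.ker (killVars s) := by
      rw [Ideal.span_le]
      rintro _ ⟨i, hi, rfl⟩
      simp [hi]
    exact this h
  · have key : f - killVars s f ∈ Ideal.span (X '' s : Set (MvPolynomial σ k)) := by
      induction f using MvPolynomial.induction_on with
      | C a => simp [killVars]
      | add p q hp hq => simpa [add_sub_add_comm] using Ideal.add_mem _ hp hq
      | mul_X p i hp =>
        rw [map_mul, killVars_X]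
        split_ifs with hi
        · simpa using Ideal.mul_mem_left _ p (Ideal.subset_span (Set.mem_image_of_mem X hi))
        · rw [← sub_mul]
          exact Ideal.mul_mem_right _ _ hp
    intro h
    simpa [h] using key

theorem isPrime_span_X_image (s : Set σ) :
    (Ideal.span (X '' s : Set (MvPolynomial σ k))).IsPrime := by
  have : Ideal.span (X '' s : Set (MvPolynomial σ k)) = RingHom.ker (killVars (k := k) s) := by
    ext f
    exact mem_span_X_image_iff_killVars
  rw [this]
  exact RingHom.ker_isPrime _

theorem span_X_image_insert (s : Set σ) (i : σ) :
    Ideal.span (X '' insert i s : Set (MvPolynomial σ k)) =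
      Ideal.span (X '' s) ⊔ Ideal.span {X i} := by
  rw [Set.image_insert_eq, Ideal.span_insert, sup_comm]

theorem ringKrullDim_quotient_span_X_insert_add_one_le {s : Set σ} {i : σ} (hi : i ∉ s) :
    ringKrullDim (MvPolynomial σ k ⧸ Ideal.span (X '' insert i s : Set (MvPolynomial σ k))) + 1 ≤
      ringKrullDim (MvPolynomial σ k ⧸ Ideal.span (X '' s : Set (MvPolynomial σ k))) := by
  rw [span_X_image_insert]
  refine ringKrullDim_quotient_sup_span_add_one_le _ fun a ha => ?_
  refine ((isPrime_span_X_image s).mem_or_mem ha).resolve_left ?_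
  rw [mem_span_X_image_iff_killVars, killVars_X, if_neg hi]
  exact X_ne_zero i

theorem dependsOnlyOn_of_isPrimary {Q : Ideal (MvPolynomial σ k)} (hQ : Q.IsPrimary) {s : Set σ}
    (hs : Q.radical = Ideal.span (X '' s)) : DependsOnlyOn s Q := by
  classical
  intro e e' he hle
  rw [← Finsupp.filter_add_filter_not e (· ∈ s), ← one_mul (1 : k), ← monomial_mul] at he
  have h1 := ((Ideal.isPrimary_iff.1 hQ).2 he).resolve_right (by
    rw [hs, monomial_mem_span_X_iff]
    rintro ⟨i, hi, h⟩
    simp [hi] at h)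
  have hle' : e.filter (· ∈ s) ≤ e' := by
    intro i
    by_cases hi : i ∈ s <;> simp [hi, hle]
  rw [← tsub_add_cancel_of_le hle', ← one_mul (1 : k), ← monomial_mul]
  exact Q.mul_mem_left _ h1

theorem exists_monomial_single_mem {Q : Ideal (MvPolynomial σ k)} {i : σ} (hi : X i ∈ Q.radical) :
    ∃ n, monomial (Finsupp.single i n) (1 : k) ∈ Q := by
  obtain ⟨n, hn⟩ := hi
  exact ⟨n, by rwa [X_pow_eq_monomial] at hn⟩

/-- A socle monomial of `Q` in the two variables `X i` and `X j`. -/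
theorem exists_socle_monomial {Q : Ideal (MvPolynomial σ k)} (hQ : Q ≠ ⊤) {i j : σ}
    (hi : ∃ n, monomial (Finsupp.single i n) (1 : k) ∈ Q)
    (hj : ∃ n, monomial (Finsupp.single j n) (1 : k) ∈ Q) :
    ∃ e : σ →₀ ℕ, (∀ l, l ≠ i → l ≠ j → e l = 0) ∧ monomial e 1 ∉ Q ∧
      monomial (e + Finsupp.single i 1) 1 ∈ Q ∧ monomial (e + Finsupp.single j 1) 1 ∈ Q := by
  classical
  have hmul (e : σ →₀ ℕ) {d : σ →₀ ℕ} (hd : monomial d (1 : k) ∈ Q) :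
      monomial (e + d) (1 : k) ∈ Q := by
    rw [← one_mul (1 : k), ← monomial_mul]
    exact Q.mul_mem_left _ hd
  obtain ⟨a, ha⟩ : ∃ a, Nat.find hi = a + 1 := Nat.exists_eq_succ_of_ne_zero fun h => by
    have := Nat.find_spec hi
    rw [h, Finsupp.single_zero] at this
    exact hQ ((Ideal.eq_top_iff_one Q).2 this)
  have hj' : ∃ n, monomial (Finsupp.single i a + Finsupp.single j n) (1 : k) ∈ Q :=
    hj.imp fun n hn => hmul _ hn
  obtain ⟨b, hb⟩ : ∃ b, Nat.find hj' = b + 1 := Nat.exists_eq_succ_of_ne_zero fun h => by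
    have := Nat.find_spec hj'
    rw [h, Finsupp.single_zero, add_zero] at this
    exact Nat.find_min hi (by omega) this
  refine ⟨Finsupp.single i a + Finsupp.single j b, fun l hli hlj => ?_,
    Nat.find_min hj' (by omega), ?_, ?_⟩
  · simp [hli.symm, hlj.symm]
  · rw [add_right_comm, add_comm, ← Finsupp.single_add, ← ha]
    exact hmul _ (Nat.find_spec hi)
  · rw [add_assoc, ← Finsupp.single_add, ← hb]
    exact Nat.find_spec hj'

section Step

variable {Q J : Ideal (MvPolynomial σ k)} {i j l : σ} {e : σ →₀ ℕ}

theorem monomial_add_mem_iff (hQij : DependsOnlyOn {i, j} Q) (he : monomial e 1 ∉ Q)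
    (hei : monomial (e + Finsupp.single i 1) 1 ∈ Q) (hej : monomial (e + Finsupp.single j 1) 1 ∈ Q)
    (d : σ →₀ ℕ) : monomial (d + e) 1 ∈ Q ↔ d i ≠ 0 ∨ d j ≠ 0 := by
  classical
  constructor
  · intro h
    by_contra! hd
    refine he (hQij h ?_)
    simp [hd]
  · rintro (h | h)
    · refine hQij hei ?_
      simp [Finsupp.single_apply]
      grind
    · refine hQij hej ?_
      simp [Finsupp.single_apply]
      grind

theorem mul_monomial_mem_iff_mem_span (hQ : IsMonomialIdeal Q) (hQij : DependsOnlyOn {i, j} Q)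
    (he : monomial e 1 ∉ Q) (hei : monomial (e + Finsupp.single i 1) 1 ∈ Q)
    (hej : monomial (e + Finsupp.single j 1) 1 ∈ Q) (c : MvPolynomial σ k) :
    c * monomial e 1 ∈ Q ↔ c ∈ Ideal.span (X '' {i, j} : Set (MvPolynomial σ k)) := by
  rw [hQ.mul_monomial_mem_iff, mem_ideal_span_X_image]
  simp [monomial_add_mem_iff hQij he hei hej]

theorem mul_monomial_mem_sup_iff (hQ : IsMonomialIdeal Q) (hQij : DependsOnlyOn {i, j} Q)
    (hJ : IsMonomialIdeal J) (hJil : DependsOnlyOn {i, l} J)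
    (he : monomial e 1 ∉ Q) (hei : monomial (e + Finsupp.single i 1) 1 ∈ Q)
    (hej : monomial (e + Finsupp.single j 1) 1 ∈ Q) (hil : i ≠ l)
    (hl : ∃ n, monomial (Finsupp.single l n) (1 : k) ∈ J) :
    ∃ n, ∀ c : MvPolynomial σ k, c * monomial e 1 ∈ J ⊔ Q ↔
      c ∈ Ideal.span (X '' {i, j} : Set (MvPolynomial σ k)) ⊔
        Ideal.span {monomial (Finsupp.single l n) 1} := by
  classical
  have hl' : ∃ n, monomial (e + Finsupp.single l n) (1 : k) ∈ J := hl.imp fun n hn => by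
    rw [← one_mul (1 : k), ← monomial_mul]
    exact J.mul_mem_left _ hn
  refine ⟨Nat.find hl', fun c => ?_⟩
  rw [(hJ.sup hQ).mul_monomial_mem_iff,
    ((isMonomialIdeal_span_X _).sup (isMonomialIdeal_span_singleton _)).mem_iff]
  refine forall₂_congr fun d _ => ?_
  rw [hJ.monomial_mem_sup_iff hQ, (isMonomialIdeal_span_X _).monomial_mem_sup_iff
    (isMonomialIdeal_span_singleton _), monomial_mem_span_singleton_iff,
    monomial_add_mem_iff hQij he hei hej, monomial_mem_span_X_iff, Finsupp.single_le_iff]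
  have hd : d i = 0 → (monomial (d + e) (1 : k) ∈ J ↔ Nat.find hl' ≤ d l) := by
    intro hdi
    constructor
    · intro h
      refine Nat.find_min' hl' (hJil h ?_)
      simp [hdi, hil, add_comm]
    · intro h
      refine hJil (Nat.find_spec hl') ?_
      simp [hdi, hil, add_comm (e l), h]
  by_cases hdi : d i = 0
  · rw [hd hdi]
    simp [hdi, or_comm]
  · simp [hdi]

/-- If `J' + Q = J + Q`, where `Q` is a monomial ideal in `X i, X j` containing powers of both
and `J` is a monomial ideal in `X i, X l` containing a power of `X l`, then `J' ⧸ (J' ∩ Q)` has a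
filtration with all factors isomorphic to the quotient by `(X i, X j)`. -/
theorem reflTransGen_inf [Finite σ] {T : Set (Ideal (MvPolynomial σ k))}
    (hT : Ideal.span (X '' {i, j}) ∈ T) (hil : i ≠ l) (hjl : j ≠ l)
    {J' : Ideal (MvPolynomial σ k)}
    (hJ : IsMonomialIdeal J) (hJil : DependsOnlyOn {i, l} J)
    (hl : ∃ n, monomial (Finsupp.single l n) (1 : k) ∈ J)
    (hQ : IsMonomialIdeal Q) (hQij : DependsOnlyOn {i, j} Q)
    (hi : ∃ n, monomial (Finsupp.single i n) (1 : k) ∈ Q)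
    (hj : ∃ n, monomial (Finsupp.single j n) (1 : k) ∈ Q)
    (hJQ : J' ⊔ Q = J ⊔ Q) : Relation.ReflTransGen (IsPrimeStep T) (J' ⊓ Q) J' := by
  induction Q using WellFoundedGT.induction with
  | ind Q ih =>
    by_cases htop : Q = ⊤
    · rw [htop, inf_top_eq]
    obtain ⟨e, he0, he, hei, hej⟩ := exists_socle_monomial htop hi hj
    obtain ⟨n, hn⟩ := mul_monomial_mem_sup_iff hQ hQij hJ hJil he hei hej hil hl
    have hle : Q ≤ Q ⊔ Ideal.span {monomial e 1} := le_sup_left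
    refine Relation.ReflTransGen.head (isPrimeStep_inf hT (isPrime_span_X_image _) ?_
      (mul_monomial_mem_iff_mem_span hQ hQij he hei hej) (hJQ ▸ hn)) (ih _ ?_ ?_ ?_ ?_ ?_ ?_)
    · rw [monomial_mem_span_X_iff]
      simp [hil.symm, hjl.symm]
    · refine lt_of_le_of_ne hle fun h => he ?_
      rw [h]
      exact Ideal.mem_sup_right (Ideal.mem_span_singleton_self _)
    · exact hQ.sup (isMonomialIdeal_span_singleton e)
    · intro d d' hd hdd'
      rw [hQ.monomial_mem_sup_iff (isMonomialIdeal_span_singleton e),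
        monomial_mem_span_singleton_iff] at hd ⊢
      refine hd.imp (fun h => hQij h hdd') fun h m => ?_
      by_cases hmi : m = i
      · exact (h m).trans (hdd' m (by simp [hmi]))
      by_cases hmj : m = j
      · exact (h m).trans (hdd' m (by simp [hmj]))
      · simp [he0 m hmi hmj]
    · exact hi.imp fun _ h => hle h
    · exact hj.imp fun _ h => hle h
    · rw [← sup_assoc, hJQ, sup_assoc]

end Step

end MonomialIdeal

section Dimension

variable {R : Type*} [CommRing R]

theorem ringKrullDim_quotient_le_of_minimalPrimes {I : Ideal R} {n : WithBot ℕ∞}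
    (h : ∀ p ∈ I.minimalPrimes, ringKrullDim (R ⧸ p) ≤ n) : ringKrullDim (R ⧸ I) ≤ n := by
  rw [ringKrullDim_quotient]
  refine iSup_le fun c => ?_
  have := c.head.1.2
  obtain ⟨p, hp, hpc⟩ := Ideal.exists_minimalPrimes_le (J := c.head.1.asIdeal) c.head.2
  refine le_trans ?_ (h p hp)
  rw [ringKrullDim_quotient]
  let c' : LTSeries (PrimeSpectrum.zeroLocus (p : Set R)) :=
    { length := c.length
      toFun := fun i => ⟨(c i).1, hpc.trans (c.head_le i)⟩
      step := c.step }
  exact Order.LTSeries.length_le_krullDim c'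

end Dimension

section FourVariables

theorem Ideal.IsPrimary.mem_of_mul_mem_left {R : Type*} [CommRing R] {Q : Ideal R}
    (hQ : Q.IsPrimary) {s a : R} (hs : s ∉ Q.radical) (h : s * a ∈ Q) : a ∈ Q :=
  ((Ideal.isPrimary_iff.1 hQ).2 (mul_comm s a ▸ h)).resolve_right hs

theorem minimalPrimes_inf_eq {R : Type*} [CommRing R] {P₁ P₂ P₃ p₁ p₂ p₃ : Ideal R}
    (hp₁ : p₁.IsPrime) (hp₂ : p₂.IsPrime) (hp₃ : p₃.IsPrime)
    (hr₁ : P₁.radical = p₁) (hr₂ : P₂.radical = p₂) (hr₃ : P₃.radical = p₃)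
    (h₁₂ : ¬ p₁ ≤ p₂) (h₁₃ : ¬ p₁ ≤ p₃) (h₂₁ : ¬ p₂ ≤ p₁) (h₂₃ : ¬ p₂ ≤ p₃) (h₃₁ : ¬ p₃ ≤ p₁)
    (h₃₂ : ¬ p₃ ≤ p₂) : (P₁ ⊓ P₂ ⊓ P₃).minimalPrimes = {p₁, p₂, p₃} := by
  have hle₁ : P₁ ⊓ P₂ ⊓ P₃ ≤ p₁ := (inf_le_left.trans inf_le_left).trans (hr₁ ▸ Ideal.le_radical)
  have hle₂ : P₁ ⊓ P₂ ⊓ P₃ ≤ p₂ := (inf_le_left.trans inf_le_right).trans (hr₂ ▸ Ideal.le_radical)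
  have hle₃ : P₁ ⊓ P₂ ⊓ P₃ ≤ p₃ := inf_le_right.trans (hr₃ ▸ Ideal.le_radical)
  have key (q : Ideal R) (hq : q.IsPrime) (h : P₁ ⊓ P₂ ⊓ P₃ ≤ q) : p₁ ≤ q ∨ p₂ ≤ q ∨ p₃ ≤ q := by
    rwa [hq.inf_le, hq.inf_le, ← hq.radical_le_iff (I := P₁), ← hq.radical_le_iff (I := P₂),
      ← hq.radical_le_iff (I := P₃), hr₁, hr₂, hr₃, or_assoc] at h
  ext q
  simp only [Set.mem_insert_iff, Set.mem_singleton_iff]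
  constructor
  · intro hq
    rcases key q hq.1.1 hq.1.2 with h | h | h
    · exact Or.inl (le_antisymm (hq.2 ⟨hp₁, hle₁⟩ h) h)
    · exact Or.inr (Or.inl (le_antisymm (hq.2 ⟨hp₂, hle₂⟩ h) h))
    · exact Or.inr (Or.inr (le_antisymm (hq.2 ⟨hp₃, hle₃⟩ h) h))
  · rintro (rfl | rfl | rfl)
    · refine ⟨⟨hp₁, hle₁⟩, fun r hr hrq => ?_⟩
      rcases key r hr.1 hr.2 with h | h | h
      exacts [h, (h₂₁ (h.trans hrq)).elim, (h₃₁ (h.trans hrq)).elim]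
    · refine ⟨⟨hp₂, hle₂⟩, fun r hr hrq => ?_⟩
      rcases key r hr.1 hr.2 with h | h | h
      exacts [(h₁₂ (h.trans hrq)).elim, h, (h₃₂ (h.trans hrq)).elim]
    · refine ⟨⟨hp₃, hle₃⟩, fun r hr hrq => ?_⟩
      rcases key r hr.1 hr.2 with h | h | h
      exacts [(h₁₃ (h.trans hrq)).elim, (h₂₃ (h.trans hrq)).elim, h]

variable {k : Type*} [Field k]

theorem span_X_image_le_iff {σ : Type*} {s t : Set σ} :
    Ideal.span (X '' s : Set (MvPolynomial σ k)) ≤ Ideal.span (X '' t) ↔ s ⊆ t := by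
  classical
  rw [Ideal.span_le, Set.image_subset_iff]
  refine forall₂_congr fun i _ => ?_
  rw [Set.mem_preimage, SetLike.mem_coe, mem_span_X_image_iff_killVars, killVars_X]
  split_ifs with h <;> simp [h]

theorem ringKrullDim_quotient_span_X_pair {i j l m : Fin 4} (h : [i, j, l, m].Nodup) :
    ringKrullDim (MvPolynomial (Fin 4) k ⧸
      Ideal.span (X '' {i, j} : Set (MvPolynomial (Fin 4) k))) = 2 := by
  simp only [List.nodup_cons, List.mem_cons, not_or, List.not_mem_nil, not_false_eq_true,
    and_true] at h
  have h₁ := ringKrullDim_quotient_span_X_insert_add_one_le (k := k) (s := ∅) (i := j) (by simp)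
  have h₂ := ringKrullDim_quotient_span_X_insert_add_one_le (k := k) (s := {j}) (i := i)
    (by simp [h])
  have h₃ := ringKrullDim_quotient_span_X_insert_add_one_le (k := k) (s := {i, j}) (i := l)
    (by simp; grind)
  have h₄ := ringKrullDim_quotient_span_X_insert_add_one_le (k := k) (s := {l, i, j}) (i := m)
    (by simp; grind)
  have h₀ : ringKrullDim (MvPolynomial (Fin 4) k ⧸
      Ideal.span (X '' (∅ : Set (Fin 4)) : Set (MvPolynomial (Fin 4) k))) ≤ 4 := by
    refine (ringKrullDim_quotient_le _).trans ?_
    simp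
  have := isPrime_span_X_image (k := k) {m, l, i, j}
  have h₅ := ringKrullDim_nonneg_of_nontrivial (R := MvPolynomial (Fin 4) k ⧸
    Ideal.span (X '' {m, l, i, j} : Set (MvPolynomial (Fin 4) k)))
  rw [insert_empty_eq] at h₁
  generalize ringKrullDim (MvPolynomial (Fin 4) k ⧸
    Ideal.span (X '' {i, j} : Set (MvPolynomial (Fin 4) k))) = d at *
  refine le_antisymm ?_ ?_
  · have h : d + 1 + 1 ≤ 2 + 1 + 1 := by
      refine le_trans ?_ (h₁.trans (h₀.trans (by norm_num)))
      gcongr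
    exact ENat.WithBot.add_le_add_one_right_iff.1 (ENat.WithBot.add_le_add_one_right_iff.1 h)
  · refine le_trans ?_ h₃
    rw [← one_add_one_eq_two]
    gcongr
    refine le_trans ?_ h₄
    simpa using add_le_add_left h₅ 1

/-- `X 1 + X 2, X 0 + X 3` is regular modulo each of `(X 0, X 1)`, `(X 0, X 2)`, `(X 2, X 3)`. -/
theorem regular_pair_span_X {s : Set (Fin 4)}
    (hs : s ∈ ({{0, 1}, {0, 2}, {2, 3}} : Set (Set (Fin 4)))) :
    (X 1 + X 2 : MvPolynomial (Fin 4) k) ∉ Ideal.span (X '' s : Set (MvPolynomial (Fin 4) k)) ∧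
    ∀ c, (X 0 + X 3) * c ∈ Ideal.span (X '' s : Set (MvPolynomial (Fin 4) k)) ⊔
        Ideal.span {X 1 + X 2} →
      c ∈ Ideal.span (X '' s : Set (MvPolynomial (Fin 4) k)) ⊔ Ideal.span {X 1 + X 2} := by
  have key {i j : Fin 4} (hi : i ∈ s) (hij : (X 1 + X 2 : MvPolynomial (Fin 4) k) = X i + X j) :
      Ideal.span (X '' s : Set (MvPolynomial (Fin 4) k)) ⊔ Ideal.span {X 1 + X 2} =
        Ideal.span (X '' insert j s : Set (MvPolynomial (Fin 4) k)) := by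
    have hXi : (X i : MvPolynomial (Fin 4) k) ∈ Ideal.span (X '' s) :=
      Ideal.subset_span (Set.mem_image_of_mem X hi)
    have hX (f : MvPolynomial (Fin 4) k) : f ∈ Ideal.span {f} := Ideal.mem_span_singleton_self f
    rw [span_X_image_insert, hij]
    refine le_antisymm (sup_le le_sup_left ?_) (sup_le le_sup_left ?_) <;>
      rw [Ideal.span_singleton_le_iff_mem]
    · exact Ideal.add_mem _ (Ideal.mem_sup_left hXi) (Ideal.mem_sup_right (hX _))
    · have := Ideal.sub_mem _ (Ideal.mem_sup_right (hX (X i + X j))) (Ideal.mem_sup_left hXi)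
      rwa [add_sub_cancel_left] at this
  have hreg {t : Set (Fin 4)} (ht : killVars t (X 0 + X 3 : MvPolynomial (Fin 4) k) ≠ 0) (c)
      (hc : (X 0 + X 3 : MvPolynomial (Fin 4) k) * c ∈ Ideal.span (X '' t)) :
      c ∈ Ideal.span (X '' t) :=
    ((isPrime_span_X_image t).mem_or_mem hc).resolve_left
      (by rwa [mem_span_X_image_iff_killVars])
  rw [mem_span_X_image_iff_killVars]
  rcases hs with rfl | rfl | rfl
  · rw [key (i := 1) (j := 2) (by simp) rfl]
    exact ⟨by simp, hreg (by simp)⟩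
  · rw [key (i := 2) (j := 1) (by simp) (add_comm _ _)]
    exact ⟨by simp, hreg (by simp)⟩
  · rw [key (i := 2) (j := 1) (by simp) (add_comm _ _)]
    exact ⟨by simp, hreg (by simp)⟩

end FourVariables


/-- For a monomial ideal `I ⊆ K[x,y,z,w]` with
`Ass(S/I) = {(x,y),(x,z),(z,w)}` and irredundant monomial primary decomposition
`I = P₁ ∩ P₂ ∩ P₃` with `√P₁ = (x,y)`, `√P₂ = (x,z)`, `√P₃ = (z,w)`, the
following are equivalent: (i) `S/I` is clean; (ii) `S/I` is Cohen–Macaulay;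
(iii) `P₂ ⊆ P₁ + P₃`. -/
theorem stmt_9 (I P₁ P₂ P₃ : Ideal S) (hI : IsMonomialIdeal I)
    (hAss : associatedPrimes S (S ⧸ I) =
      {Ideal.span {X 0, X 1}, Ideal.span {X 0, X 2}, Ideal.span {X 2, X 3}})
    (hm : IsMonomialIdeal P₁ ∧ IsMonomialIdeal P₂ ∧ IsMonomialIdeal P₃)
    (hp : P₁.IsPrimary ∧ P₂.IsPrimary ∧ P₃.IsPrimary)
    (hr₁ : P₁.radical = Ideal.span {X 0, X 1})
    (hr₂ : P₂.radical = Ideal.span {X 0, X 2})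
    (hr₃ : P₃.radical = Ideal.span {X 2, X 3})
    (hdec : I = P₁ ⊓ P₂ ⊓ P₃)
    (hirr : I ≠ P₂ ⊓ P₃ ∧ I ≠ P₁ ⊓ P₃ ∧ I ≠ P₁ ⊓ P₂) :
    [ IsClean I, IsCM S m4 (S ⧸ I), P₂ ≤ P₁ + P₃ ].TFAE := by
  obtain ⟨hm₁, hm₂, hm₃⟩ := hm
  obtain ⟨hp₁, hp₂, hp₃⟩ := hp
  have hX (i j : Fin 4) : ({X i, X j} : Set S) = X '' {i, j} := (Set.image_pair ..).symm
  simp only [hX] at hAss hr₁ hr₂ hr₃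
  have hmin : I.minimalPrimes = {Ideal.span (X '' {0, 1} : Set S), Ideal.span (X '' {0, 2}),
      Ideal.span (X '' {2, 3})} := by
    rw [hdec]
    refine minimalPrimes_inf_eq (isPrime_span_X_image _) (isPrime_span_X_image _)
      (isPrime_span_X_image _) hr₁ hr₂ hr₃ ?_ ?_ ?_ ?_ ?_ ?_ <;>
      simp [span_X_image_le_iff, Set.insert_subset_iff]
  have hdim : ringKrullDim (S ⧸ I) = 2 := by
    have hdim₁ : ringKrullDim (S ⧸ Ideal.span (X '' {0, 1} : Set S)) = 2 :=
      ringKrullDim_quotient_span_X_pair (l := 2) (m := 3) (by decide)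
    refine le_antisymm (ringKrullDim_quotient_le_of_minimalPrimes fun p hp => ?_) ?_
    · rw [hmin] at hp
      rcases hp with rfl | rfl | rfl
      · exact hdim₁.le
      · exact (ringKrullDim_quotient_span_X_pair (l := 1) (m := 3) (by decide)).le
      · exact (ringKrullDim_quotient_span_X_pair (l := 0) (m := 1) (by decide)).le
    · have hle : I ≤ Ideal.span (X '' {0, 1} : Set S) :=
        hdec ▸ (inf_le_left.trans inf_le_left).trans (hr₁ ▸ Ideal.le_radical)
      rw [← hdim₁]
      exact ringKrullDim_le_of_surjective _ (Ideal.Quotient.factor_surjective hle)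
  tfae_have 3 → 1 := by
    intro h
    rw [isClean_iff_reflTransGen, hmin, hdec]
    have hpow {s : Set (Fin 4)} {Q : Ideal S} (hQ : Q.radical = Ideal.span (X '' s)) {i : Fin 4}
        (hi : i ∈ s) : ∃ n, monomial (Finsupp.single i n) 1 ∈ Q :=
      exists_monomial_single_mem (hQ ▸ Ideal.subset_span (Set.mem_image_of_mem X hi))
    have hd₁ := dependsOnlyOn_of_isPrimary hp₁ hr₁
    have hd₂ := dependsOnlyOn_of_isPrimary hp₂ hr₂
    have hd₃ := dependsOnlyOn_of_isPrimary hp₃ hr₃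
    have hsup : P₁ ⊓ P₂ ⊔ P₃ = P₂ ⊔ P₃ := by
      refine le_antisymm (sup_le_sup_right inf_le_right _) (sup_le (fun f hf => ?_) le_sup_right)
      refine mem_of_forall_support fun e he => ?_
      have he₂ := hm₂.mem_iff.1 hf e he
      rcases (hm₁.monomial_mem_sup_iff hm₃).1 (h he₂) with he₁ | he₃
      exacts [Ideal.mem_sup_left ⟨he₁, he₂⟩, Ideal.mem_sup_right he₃]
    have hm_top : IsMonomialIdeal (⊤ : Ideal S) :=
      ⟨{1}, by simpa using ⟨0, rfl⟩, Ideal.span_singleton_one.symm⟩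
    refine (reflTransGen_inf (i := 2) (j := 3) (l := 0) (by simp) (by decide) (by decide) hm₂
      (Set.pair_comm (0 : Fin 4) 2 ▸ hd₂) (hpow hr₂ (by simp)) hm₃ hd₃ (hpow hr₃ (by simp))
      (hpow hr₃ (by simp)) hsup).trans ?_
    refine (reflTransGen_inf (i := 0) (j := 2) (l := 1) (by simp) (by decide) (by decide) hm₁
      hd₁ (hpow hr₁ (by simp)) hm₂ hd₂ (hpow hr₂ (by simp)) (hpow hr₂ (by simp)) rfl).trans ?_
    simpa using reflTransGen_inf (J' := ⊤) (i := 0) (j := 1) (l := 2) (by simp) (by decide)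
      (by decide) hm_top (fun _ _ _ _ => Submodule.mem_top) ⟨0, Submodule.mem_top⟩ hm₁ hd₁
      (hpow hr₁ (by simp)) (hpow hr₁ (by simp)) rfl
  tfae_have 1 → 2 := by
    intro h
    rw [isClean_iff_reflTransGen, hmin] at h
    have hmem : ∀ p ∈ ({Ideal.span (X '' {0, 1} : Set S), Ideal.span (X '' {0, 2}),
        Ideal.span (X '' {2, 3})} : Set (Ideal S)), ∃ s ∈ ({{0, 1}, {0, 2}, {2, 3}} :
          Set (Set (Fin 4))), p = Ideal.span (X '' s) := by
      simp
    obtain ⟨hf, hg⟩ := regular_pair_of_reflTransGen (f := X 1 + X 2) (g := X 0 + X 3) h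
      (fun p hp => by obtain ⟨s, hs, rfl⟩ := hmem p hp; exact (regular_pair_span_X hs).1)
      (fun p hp => by obtain ⟨s, hs, rfl⟩ := hmem p hp; exact (regular_pair_span_X hs).2)
    have hfm : X 1 + X 2 ∈ m4 :=
      Ideal.add_mem _ (Ideal.subset_span (by simp)) (Ideal.subset_span (by simp))
    have hgm : X 0 + X 3 ∈ m4 :=
      Ideal.add_mem _ (Ideal.subset_span (by simp)) (Ideal.subset_span (by simp))
    have hIm : I ≤ m4 := by
      rw [hdec]
      refine inf_le_right.trans (Ideal.le_radical.trans (hr₃.le.trans (Ideal.span_mono ?_)))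
      simp [Set.insert_subset_iff, Set.image_pair]
    have hm_ne : m4 ≠ ⊤ := by
      have := (isPrime_span_X_image (k := K) ({0, 1, 2, 3} : Set (Fin 4))).ne_top
      simpa only [Set.image_insert_eq, Set.image_singleton] using this
    have : Nontrivial (S ⧸ I ⊔ Ideal.span {X 1 + X 2} ⊔ Ideal.span {X 0 + X 3}) := by
      refine Ideal.Quotient.nontrivial_iff.2 (ne_top_of_le_ne_top hm_ne ?_)
      simp only [sup_le_iff, Ideal.span_singleton_le_iff_mem]
      exact ⟨⟨hIm, hfm⟩, hgm⟩
    refine isCM_of_isRegular (rs := [X 1 + X 2, X 0 + X 3]) (by simp [hfm, hgm]) ?_ hdim.le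
    rw [isRegular_quotient_cons_iff, isRegular_quotient_cons_iff]
    exact ⟨hf, hg, RingTheory.Sequence.IsRegular.nil _ _⟩
  tfae_have 2 → 3 := by
    intro h
    obtain ⟨rs, hlen, hrs, hreg⟩ := exists_isRegular_of_isCM (n := 2) h hdim.ge
    match rs, hlen with
    | s :: t :: _, _ =>
      simp only [isRegular_quotient_cons_iff] at hreg
      obtain ⟨hs, ht, -⟩ := hreg
      rw [Submodule.add_eq_sup]
      by_contra hle
      obtain ⟨u, hu₂, hu⟩ := SetLike.not_le_iff_exists.1 hle
      have hsP {p : Ideal S} (hp : p ∈ associatedPrimes S (S ⧸ I)) : s ∉ p := by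
        intro hsp
        have hs' := biUnion_associatedPrimes_eq_compl_regular S (S ⧸ I) ▸
          Set.mem_biUnion hp hsp
        exact hs' ((isSMulRegular_quotient_iff_mem_of_smul_mem I s).2 hs)
      rw [hAss] at hsP
      have hs₁ (a : S) := hp₁.mem_of_mul_mem_left (s := s) (a := a) (by simp [hr₁, hsP])
      have hs₂ (a : S) := hp₂.mem_of_mul_mem_left (s := s) (a := a) (by simp [hr₂, hsP])
      have hs₃ (a : S) := hp₃.mem_of_mul_mem_left (s := s) (a := a) (by simp [hr₃, hsP])
      have hle' : P₁ ⊓ P₂ ⊔ P₃ ≤ P₁ ⊔ P₃ := sup_le_sup_right inf_le_left _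
      have huJ : u ∉ P₁ ⊓ P₂ ⊔ P₃ := fun h => hu (hle' h)
      let C : Ideal S := Submodule.comap (LinearMap.toSpanSingleton S S u) (P₁ ⊓ P₂ ⊔ P₃)
      have hC : P₁ ⊔ P₃ ≤ C := sup_le
        (fun a ha => Submodule.mem_sup_left
          ⟨Ideal.mul_mem_right u P₁ ha, Ideal.mul_mem_left P₂ a hu₂⟩)
        (fun a ha => Submodule.mem_sup_right (Ideal.mul_mem_right u P₃ ha))
      have hmC : m4 ≤ C.radical := by
        have h₁ := Ideal.radical_mono (le_sup_left.trans hC)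
        have h₃ := Ideal.radical_mono (le_sup_right.trans hC)
        rw [hr₁, Ideal.span_le, Set.image_pair, Set.insert_subset_iff,
          Set.singleton_subset_iff] at h₁
        rw [hr₃, Ideal.span_le, Set.image_pair, Set.insert_subset_iff,
          Set.singleton_subset_iff] at h₃
        rw [Ideal.span_le]
        simp only [Set.insert_subset_iff, Set.singleton_subset_iff]
        exact ⟨h₁.1, h₁.2, h₃⟩
      obtain ⟨n, hn⟩ := C.exists_radical_pow_le_of_fg (Ideal.fg_of_isNoetherianRing _)
      obtain ⟨v, hv, hmv⟩ := exists_socle_of_pow_mul_le huJ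
        (fun r hr => ((Ideal.pow_right_mono hmC n).trans hn) hr)
      refine hv (mem_sup_of_regular_pair (s := s) (t := t) (fun a ha => ⟨hs₁ a ha.1, hs₂ a ha.2⟩)
        hs₃ (hdec ▸ ht) (hmv s (hrs s (by simp))) (hmv t (hrs t (by simp))))
  tfae_finish
end

section
/- Let K be a field, S = K[x,y,z,w], and I ⊆ S a monomial ideal with Ass(S/I) = {(x,y), (x,z), (z,w)} and irredundant primary decomposition I = P₁ ∩ P₂ ∩ P₃ into monomial primary ideals with √P₁ = (x,y), √P₂ = (x,z), √P₃ = (z,w). If P₂ ⊄ P₁ + P₃, then depth(S/(P₁ ∩ P₂ + P₃)) = 0 and depth(S/I) = 1; in particular S/I is not Cohen–Macaulay. -/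
open MvPolynomial

section RegularSequences

variable {R : Type*} [CommRing R]

theorem isSMulRegular_quotient_iff_mul_mem {I : Ideal R} {r : R} :
    IsSMulRegular (R ⧸ I) r ↔ ∀ s, r * s ∈ I → s ∈ I :=
  isSMulRegular_quotient_iff_mem_of_smul_mem I r

open scoped Pointwise in
theorem mem_smul_top_quotient_iff {I : Ideal R} {f s : R} :
    (Ideal.Quotient.mk I s) ∈ (f • (⊤ : Submodule R (R ⧸ I))) ↔ ∃ h, s - f * h ∈ I := by
  rw [Submodule.mem_smul_pointwise_iff_exists]
  constructor
  · rintro ⟨h, -, e⟩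
    obtain ⟨h, rfl⟩ := Ideal.Quotient.mk_surjective h
    exact ⟨h, Ideal.Quotient.eq.1 e.symm⟩
  · rintro ⟨h, e⟩
    exact ⟨Ideal.Quotient.mk I h, trivial, (Ideal.Quotient.eq.2 e).symm⟩

/-- If `f` is regular modulo `Q` and modulo `P`, and `f`, `g` both act nilpotently on a nonzero
class of `R ⧸ (Q + P)`, then `g` is not regular on `R ⧸ (Q ⊓ P)` modulo `f`. -/
theorem not_isSMulRegular_quotSMulTop_quotient_inf {Q P : Ideal R} {u f g : R}
    (hfQ : ∀ s, f * s ∈ Q → s ∈ Q) (hfP : ∀ s, f * s ∈ P → s ∈ P) (hu : u ∉ Q + P)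
    (hf : ∃ k : ℕ, f ^ k * u ∈ Q + P) (hg : ∃ n : ℕ, g ^ n * u ∈ Q + P) :
    ¬ IsSMulRegular (QuotSMulTop f (R ⧸ (Q ⊓ P))) g := by
  intro hreg
  obtain ⟨n, hn⟩ := hg
  obtain ⟨v, hv, hfv, hgv⟩ : ∃ v, v ∉ Q + P ∧ f * v ∈ Q + P ∧ g ^ n * v ∈ Q + P := by
    classical
    obtain ⟨k, hk⟩ : ∃ k, Nat.find hf = k + 1 :=
      Nat.exists_eq_succ_of_ne_zero fun h => hu (by simpa [h] using Nat.find_spec hf)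
    refine ⟨f ^ k * u, Nat.find_min hf (by omega), ?_, ?_⟩
    · have := Nat.find_spec hf
      rwa [hk, pow_succ', mul_assoc] at this
    · rw [mul_left_comm]
      exact Ideal.mul_mem_left _ _ hn
  obtain ⟨a, ha, b, hb, hab⟩ := Submodule.mem_sup.1 hfv
  obtain ⟨c, hc, d, hd, hcd⟩ := Submodule.mem_sup.1 hgv
  have hreg' := (isSMulRegular_quotient_iff_mem_of_smul_mem _ _).1 (hreg.pow n)
  obtain ⟨h, hh⟩ := mem_smul_top_quotient_iff.1 <| hreg' (Ideal.Quotient.mk (Q ⊓ P) b) <|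
    (mem_smul_top_quotient_iff (s := g ^ n * b)).2 ⟨d, by
      refine ⟨?_, P.sub_mem (P.mul_mem_left _ hb) (P.mul_mem_left _ hd)⟩
      have : g ^ n * b - f * d = f * c - g ^ n * a := by
        linear_combination g ^ n * hab - f * hcd
      rw [this]
      exact Q.sub_mem (Q.mul_mem_left _ hc) (Q.mul_mem_left _ ha)⟩
  have hP : h ∈ P := hfP h <| by simpa using P.sub_mem hb hh.2
  have hQ : v - h ∈ Q := hfQ _ <| by
    have : f * (v - h) = (b - f * h) + a := by linear_combination -hab
    rw [this]
    exact Q.add_mem hh.1 ha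
  exact hv (by simpa using Submodule.add_mem_sup hQ hP)

theorem exists_pow_mul_mem_inf_add {P₁ P₂ P₃ : Ideal R} {u r : R} (hu : u ∈ P₂)
    (hr : r ∈ P₁.radical ⊔ P₃.radical) : ∃ n : ℕ, r ^ n * u ∈ P₁ ⊓ P₂ + P₃ := by
  have : r ∈ (P₁ ⊔ P₃).radical :=
    (sup_le (Ideal.radical_mono le_sup_left) (Ideal.radical_mono le_sup_right) :
      P₁.radical ⊔ P₃.radical ≤ (P₁ ⊔ P₃).radical) hr
  obtain ⟨n, hn⟩ := this
  obtain ⟨p, hp, q, hq, hpq⟩ := Submodule.mem_sup.1 hn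
  refine ⟨n, ?_⟩
  rw [← hpq, add_mul]
  exact Submodule.add_mem_sup ⟨P₁.mul_mem_right _ hp, P₂.mul_mem_left _ hu⟩
    (P₃.mul_mem_right _ hq)

theorem Ideal.IsPrimary.mem_of_mul_mem {P : Ideal R} (hP : P.IsPrimary) {f : R}
    (hf : f ∉ P.radical) (s : R) (hs : f * s ∈ P) : s ∈ P :=
  ((Ideal.isPrimary_iff.1 hP).2 (mul_comm f s ▸ hs)).resolve_right hf

theorem mDepth_le {m : Ideal R} {M : Type*} [AddCommGroup M] [Module R M] {n : ℕ∞}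
    (h : ∀ rs : List R, (∀ r ∈ rs, r ∈ m) → RingTheory.Sequence.IsRegular M rs →
      (rs.length : ℕ∞) ≤ n) : mDepth R m M ≤ n :=
  sSup_le <| by
    rintro _ ⟨rs, rfl, hrs, hreg⟩
    exact h rs hrs hreg

theorem length_le_mDepth {m : Ideal R} {M : Type*} [AddCommGroup M] [Module R M]
    {rs : List R} (hrs : ∀ r ∈ rs, r ∈ m) (hreg : RingTheory.Sequence.IsRegular M rs) :
    (rs.length : ℕ∞) ≤ mDepth R m M :=
  le_sSup ⟨rs, rfl, hrs, hreg⟩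

end RegularSequences

theorem eval_eq_zero_of_mem_span_pair {σ A : Type*} [CommRing A] {a b : σ} {p : σ → A}
    (ha : p a = 0) (hb : p b = 0) {f : MvPolynomial σ A}
    (hf : f ∈ Ideal.span {(X a : MvPolynomial σ A), X b}) : eval p f = 0 := by
  obtain ⟨c, d, rfl⟩ := Ideal.mem_span_pair.1 hf
  simp [ha, hb]

theorem two_le_ringKrullDim_quotient {F : Type*} [Field F] {I : Ideal (MvPolynomial (Fin 4) F)}
    (hI : I ≤ Ideal.span {X 0, X 1}) : 2 ≤ ringKrullDim (MvPolynomial (Fin 4) F ⧸ I) := by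
  let φ : MvPolynomial (Fin 4) F →ₐ[F] MvPolynomial (Fin 2) F := aeval ![0, 0, X 0, X 1]
  have hφ : Function.Surjective φ := by
    rw [← AlgHom.range_eq_top, ← top_le_iff, ← MvPolynomial.adjoin_range_X, Algebra.adjoin_le_iff]
    rintro _ ⟨i, rfl⟩
    fin_cases i
    · exact ⟨X 2, by simp [φ]⟩
    · exact ⟨X 3, by simp [φ]⟩
  have hker : ∀ a ∈ I, (φ : MvPolynomial (Fin 4) F →+* MvPolynomial (Fin 2) F) a = 0 := by
    intro a ha
    obtain ⟨c, d, rfl⟩ := Ideal.mem_span_pair.1 (hI ha)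
    simp [φ]
  have := ringKrullDim_le_of_surjective (Ideal.Quotient.lift I _ hker)
    (Ideal.Quotient.lift_surjective_of_surjective I hker hφ)
  rw [MvPolynomial.ringKrullDim_of_isNoetherianRing] at this
  simpa using this

variable {K : Type*} [Field K]

local notation "S" => MvPolynomial (Fin 4) K
local notation "m4" => (Ideal.span {(X 0 : MvPolynomial (Fin 4) K), X 1, X 2, X 3})

/-- For a monomial ideal `I ⊆ K[x,y,z,w]` with
`Ass(S/I) = {(x,y),(x,z),(z,w)}` and irredundant monomial primary decomposition
`I = P₁ ∩ P₂ ∩ P₃` with `√P₁ = (x,y)`, `√P₂ = (x,z)`, `√P₃ = (z,w)`: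
if `P₂ ⊄ P₁ + P₃` then `depth (S/(P₁ ∩ P₂ + P₃)) = 0` and `depth (S/I) = 1`;
in particular `S/I` is not Cohen–Macaulay. -/
theorem stmt_15 (I P₁ P₂ P₃ : Ideal S) (hI : IsMonomialIdeal I)
    (hAss : associatedPrimes S (S ⧸ I) =
      {Ideal.span {X 0, X 1}, Ideal.span {X 0, X 2}, Ideal.span {X 2, X 3}})
    (hm : IsMonomialIdeal P₁ ∧ IsMonomialIdeal P₂ ∧ IsMonomialIdeal P₃)
    (hp : P₁.IsPrimary ∧ P₂.IsPrimary ∧ P₃.IsPrimary)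
    (hr₁ : P₁.radical = Ideal.span {X 0, X 1})
    (hr₂ : P₂.radical = Ideal.span {X 0, X 2})
    (hr₃ : P₃.radical = Ideal.span {X 2, X 3})
    (hdec : I = P₁ ⊓ P₂ ⊓ P₃)
    (hirr : I ≠ P₂ ⊓ P₃ ∧ I ≠ P₁ ⊓ P₃ ∧ I ≠ P₁ ⊓ P₂)
    (hnle : ¬ P₂ ≤ P₁ + P₃) :
    mDepth S m4 (S ⧸ (P₁ ⊓ P₂ + P₃)) = 0 ∧ mDepth S m4 (S ⧸ I) = 1 ∧
      ¬ IsCM S m4 (S ⧸ I) := by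
  obtain ⟨hp₁, hp₂, hp₃⟩ := hp
  obtain ⟨u, hu₂, hu⟩ := Set.not_subset.1 hnle
  have huJ : u ∉ P₁ ⊓ P₂ + P₃ := fun h => hu (sup_le_sup_right inf_le_left P₃ h)
  have hpow : ∀ r ∈ m4, ∃ n : ℕ, r ^ n * u ∈ P₁ ⊓ P₂ + P₃ := by
    intro r hr
    refine exists_pow_mul_mem_inf_add hu₂ ?_
    rw [hr₁, hr₃, ← Ideal.span_union]
    refine Ideal.span_mono ?_ hr
    rintro _ (rfl | rfl | rfl | rfl) <;> simp
  have hI₁ : I ≤ Ideal.span {X 0, X 1} :=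
    (hdec.le.trans (inf_le_left.trans inf_le_left)).trans (Ideal.le_radical.trans hr₁.le)
  have hnotMem : ∀ f : S, IsSMulRegular (S ⧸ I) f → ∀ P ∈ associatedPrimes S (S ⧸ I), f ∉ P := by
    intro f hf P hP hfP
    have := Set.mem_biUnion hP hfP
    rw [biUnion_associatedPrimes_eq_compl_regular] at this
    exact this hf
  have hprimary : ∀ f : S, f ∉ P₁.radical → f ∉ P₂.radical → f ∉ P₃.radical →
      (∀ s, f * s ∈ P₁ ⊓ P₂ → s ∈ P₁ ⊓ P₂) ∧ ∀ s, f * s ∈ P₃ → s ∈ P₃ := fun f h₁ h₂ h₃ =>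
    ⟨fun s hs => ⟨hp₁.mem_of_mul_mem h₁ s hs.1, hp₂.mem_of_mul_mem h₂ s hs.2⟩,
      hp₃.mem_of_mul_mem h₃⟩
  have hdepth : mDepth S m4 (S ⧸ I) = 1 := by
    apply le_antisymm
    · refine mDepth_le fun rs hrs hreg => ?_
      match rs, hrs, hreg with
      | [], _, _ => simp
      | [_], _, _ => simp
      | f :: g :: rs, hrs, hreg =>
        obtain ⟨hf, hreg⟩ := (RingTheory.Sequence.isRegular_cons_iff _ _ _).1 hreg
        obtain ⟨hg, -⟩ := (RingTheory.Sequence.isRegular_cons_iff _ _ _).1 hreg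
        have hnot := hnotMem f hf
        rw [hAss] at hnot
        obtain ⟨hfQ, hfP⟩ := hprimary f (hr₁ ▸ hnot _ (by simp)) (hr₂ ▸ hnot _ (by simp))
          (hr₃ ▸ hnot _ (by simp))
        subst hdec
        exact (not_isSMulRegular_quotSMulTop_quotient_inf hfQ hfP huJ
          (hpow f (hrs f (by simp))) (hpow g (hrs g (by simp))) hg).elim
    · have hmem : ∀ r ∈ [(X 1 + X 2 : S)], r ∈ m4 := by
        rintro r hr
        rw [List.mem_singleton.1 hr]
        exact add_mem (Ideal.subset_span (by simp)) (Ideal.subset_span (by simp))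
      refine length_le_mDepth hmem ?_
      have hnot₁ : (X 1 + X 2 : S) ∉ P₁.radical := fun h => by
        rw [hr₁] at h
        simpa using eval_eq_zero_of_mem_span_pair (p := Pi.single 2 (1 : K)) (by simp) (by simp) h
      have hnot₂ : (X 1 + X 2 : S) ∉ P₂.radical := fun h => by
        rw [hr₂] at h
        simpa using eval_eq_zero_of_mem_span_pair (p := Pi.single 1 (1 : K)) (by simp) (by simp) h
      have hnot₃ : (X 1 + X 2 : S) ∉ P₃.radical := fun h => by
        rw [hr₃] at h
        simpa using eval_eq_zero_of_mem_span_pair (p := Pi.single 1 (1 : K)) (by simp) (by simp) h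
      obtain ⟨hfQ, hfP⟩ := hprimary _ hnot₁ hnot₂ hnot₃
      refine ⟨(RingTheory.Sequence.isWeaklyRegular_singleton_iff _ _).2 <|
        isSMulRegular_quotient_iff_mul_mem.2 ?_, fun h => ?_⟩
      · rw [hdec]
        exact fun s hs => ⟨hfQ s hs.1, hfP s hs.2⟩
      · rw [Ideal.ofList_singleton, Submodule.ideal_span_singleton_smul] at h
        obtain ⟨q, hq⟩ := mem_smul_top_quotient_iff.1
          (h ▸ Submodule.mem_top : Ideal.Quotient.mk I 1 ∈ _)
        simpa using eval_eq_zero_of_mem_span_pair (p := 0) rfl rfl (hI₁ hq)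
  refine ⟨?_, hdepth, fun hCM => ?_⟩
  · refine nonpos_iff_eq_zero.1 <| mDepth_le fun rs hrs hreg => ?_
    match rs, hrs, hreg with
    | [], _, _ => simp
    | r :: rs, hrs, hreg =>
      obtain ⟨hr, -⟩ := (RingTheory.Sequence.isRegular_cons_iff _ _ _).1 hreg
      obtain ⟨n, hn⟩ := hpow r (hrs r (by simp))
      exact (huJ (isSMulRegular_quotient_iff_mul_mem.1 (hr.pow n) u hn)).elim
  · have hdim := two_le_ringKrullDim_quotient hI₁
    rw [IsCM, hdepth, Ideal.annihilator_quotient] at hCM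
    rw [← hCM] at hdim
    exact absurd hdim (by decide)
end
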